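/- Let a(n) be the number of Dyck paths of semi-length n such that no peak height and no valley height lies in the arithmetic progression {5r+1 : r >= 0} = {1, 6, 11, 16, ...}, and let f = \sum_{n\ge 0} a(n) x^n in the ring of formal power series over the integers. Then (x^3 + x^2 - x) f^2 + (x^3 - 2x^2 - x + 1) f + 2x - 1 = 0. -/

import Mathlib

open Finset PowerSeries

/-- A word over the step alphabet (`true` = U = (1,1), `false` = D = (1,-1)) is a
Dyck path if it has equally many U's and D's and every prefix has at least as
many U's as D's (i.e. the lattice path never goes below the x-axis). -/
def IsDyck (w : List Bool) : Prop :=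
  w.count true = w.count false ∧
    ∀ k, (w.take k).count false ≤ (w.take k).count true
/-- The height (y-coordinate) of the lattice point reached after the first `k` steps. -/
def ht (w : List Bool) (k : ℕ) : ℕ :=
  (w.take k).count true - (w.take k).count false
/-- The word `w` has a peak (an occurrence of the factor `UD`) at position `i`;
the height of this peak is `ht w (i+1)`. -/
def IsPeakAt (w : List Bool) (i : ℕ) : Prop :=
  w[i]? = some true ∧ w[i + 1]? = some false
/-- The word `w` has a valley (an occurrence of the factor `DU`) at position `i`;
the height of this valley is `ht w (i+1)`. -/
def IsValleyAt (w : List Bool) (i : ℕ) : Prop :=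
  w[i]? = some false ∧ w[i + 1]? = some true

/-- The Dyck word of a binary tree: `l △ r` becomes `U l D r`. -/
def treeWord : BinaryTree Unit → List Bool
  | .nil => []
  | .node _ l r => true :: (treeWord l ++ false :: treeWord r)

/-- The path `w`, started at height `h`, never goes below height `0`. -/
def StaysNonneg : ℕ → List Bool → Prop
  | _, [] => True
  | h, true :: w => StaysNonneg (h + 1) w
  | h, false :: w => 1 ≤ h ∧ StaysNonneg (h - 1) w

/-- The path `w`, started at height `h` after a step `p`, changes direction only at heights
not congruent to `1` modulo `5`. -/
def TurnsAvoid : Bool → ℕ → List Bool → Prop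
  | _, _, [] => True
  | p, h, true :: w => (p = false → h % 5 ≠ 1) ∧ TurnsAvoid true (h + 1) w
  | p, h, false :: w => (p = true → h % 5 ≠ 1) ∧ TurnsAvoid false (h - 1) w

/-- The condition on a binary tree expressing that its Dyck word, started at height `h` after a
step `p` and followed by a down step whenever it is a left subtree, satisfies `TurnsAvoid`. -/
def TreeAvoids : Bool → ℕ → BinaryTree Unit → Prop
  | _, _, .nil => True
  | p, h, .node _ l r => (p = false → h % 5 ≠ 1) ∧
      (TreeAvoids true (h + 1) l ∧ (l = .nil → (h + 1) % 5 ≠ 1)) ∧ TreeAvoids false h r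

theorem count_treeWord (t : BinaryTree Unit) (b : Bool) :
    (treeWord t).count b = t.numNodes := by
  induction t with
  | nil => simp [treeWord, BinaryTree.numNodes]
  | node _ l r hl hr =>
    cases b
    · simp [treeWord, BinaryTree.numNodes, hl, hr]
      omega
    · simp [treeWord, BinaryTree.numNodes, hl, hr]

theorem treeWord_append_false_inj (t t' : BinaryTree Unit) (u u' : List Bool)
    (h : treeWord t ++ false :: u = treeWord t' ++ false :: u') : t = t' ∧ u = u' := by
  induction t generalizing t' u u' with
  | nil => cases t' <;> simp_all [treeWord]
  | node _ l r hl hr =>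
    cases t' with
    | nil => simp [treeWord] at h
    | node _ l' r' =>
      simp only [treeWord, List.cons_append, List.append_assoc, List.cons.injEq, true_and] at h
      obtain ⟨rfl, h2⟩ := hl _ _ _ h
      obtain ⟨rfl, rfl⟩ := hr _ _ _ h2
      simp

theorem treeWord_injective : Function.Injective treeWord := fun t t' h =>
  (treeWord_append_false_inj t t' [] [] (by rw [h])).1

theorem exists_treeWord_append (w : List Bool) (hw : w.count true ≤ w.count false) :
    ∃ t v, w = treeWord t ++ v ∧ (v = [] ∨ ∃ v', v = false :: v') := by
  match w with
  | [] => exact ⟨.nil, [], by simp [treeWord]⟩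
  | false :: w => exact ⟨.nil, false :: w, by simp [treeWord]⟩
  | true :: w =>
    simp only [List.count_cons_self, ne_eq, Bool.true_eq_false, not_false_eq_true,
      List.count_cons_of_ne] at hw
    obtain ⟨l, v, hlv, hv⟩ := exists_treeWord_append w (by omega)
    rw [hlv] at hw
    obtain rfl | ⟨v', rfl⟩ := hv
    · simp [count_treeWord] at hw
    · simp only [List.count_append, count_treeWord, List.count_cons_self, ne_eq,
        Bool.false_eq_true, not_false_eq_true, List.count_cons_of_ne] at hw
      have hlen : v'.length < w.length + 1 := by
        rw [hlv, List.length_append, List.length_cons]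
        omega
      obtain ⟨r, v, rfl, hv⟩ := exists_treeWord_append v' (by omega)
      exact ⟨.node () l r, v, by simp [treeWord, hlv], hv⟩
termination_by w.length

theorem staysNonneg_treeWord_append (t : BinaryTree Unit) (h : ℕ) (v : List Bool) :
    StaysNonneg h (treeWord t ++ v) ↔ StaysNonneg h v := by
  induction t generalizing h v with
  | nil => simp [treeWord]
  | node _ l r hl hr => simp [treeWord, StaysNonneg, hl, hr]

theorem staysNonneg_iff (w : List Bool) (h : ℕ) :
    StaysNonneg h w ↔ ∀ k, (w.take k).count false ≤ h + (w.take k).count true := by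
  induction w generalizing h with
  | nil => simp [StaysNonneg]
  | cons s w ih =>
    rw [← Nat.and_forall_add_one]
    cases s
    · simp only [StaysNonneg, ih, List.take_zero, List.count_nil, List.take_succ_cons,
        List.count_cons_self, ne_eq, Bool.false_eq_true, not_false_eq_true,
        List.count_cons_of_ne, zero_le, true_and]
      refine ⟨fun ⟨_, h2⟩ n => by have := h2 n; omega, fun h' => ⟨?_, fun k => ?_⟩⟩
      · have := h' 0
        simp at this
        omega
      · have := h' k
        omega
    · simp [StaysNonneg, ih, add_assoc, add_comm 1]

theorem isDyck_treeWord (t : BinaryTree Unit) : IsDyck (treeWord t) := by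
  refine ⟨by simp [count_treeWord], ?_⟩
  have h := (staysNonneg_treeWord_append t 0 []).2 trivial
  rw [List.append_nil, staysNonneg_iff] at h
  simpa using h

theorem exists_treeWord_of_isDyck (w : List Bool) (hw : IsDyck w) : ∃ t, treeWord t = w := by
  obtain ⟨t, v, rfl, rfl | ⟨v', rfl⟩⟩ := exists_treeWord_append w hw.1.le
  · exact ⟨t, by simp⟩
  · have h := (staysNonneg_iff _ 0).2 (by simpa using hw.2)
    simp [staysNonneg_treeWord_append, StaysNonneg] at h

theorem turnsAvoid_treeWord_append (t : BinaryTree Unit) (p : Bool) (h : ℕ) (v : List Bool) :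
    TurnsAvoid p h (treeWord t ++ v) ↔
      TreeAvoids p h t ∧ TurnsAvoid (if t = .nil then p else false) h v := by
  induction t generalizing p h v with
  | nil => simp [treeWord, TreeAvoids]
  | node _ l r hl hr =>
    simp only [treeWord, List.cons_append, List.append_assoc, TurnsAvoid, hl, hr, TreeAvoids]
    by_cases hl : l = .nil <;> by_cases hr : r = .nil <;> simp [hl, hr] <;> tauto

theorem turnsAvoid_iff (w : List Bool) (p : Bool) (h : ℕ) (hw : StaysNonneg h w) :
    TurnsAvoid p h w ↔ ∀ i s, (p :: w)[i]? = some s → w[i]? = some (!s) →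
      (h + (w.take i).count true - (w.take i).count false) % 5 ≠ 1 := by
  induction w generalizing p h with
  | nil => simp [TurnsAvoid]
  | cons s w ih =>
    rw [← Nat.and_forall_add_one]
    cases s
    · obtain ⟨h1, h2⟩ := hw
      obtain ⟨h, rfl⟩ : ∃ k, h = k + 1 := ⟨h - 1, by omega⟩
      have e (i : ℕ) : h + 1 + (w.take i).count true - ((w.take i).count false + 1) =
        h + (w.take i).count true - (w.take i).count false := by omega
      simp only [TurnsAvoid, ih _ _ h2]
      cases p <;> simp [e]
    · have e (i : ℕ) : h + ((w.take i).count true + 1) = h + 1 + (w.take i).count true := by omega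
      simp only [TurnsAvoid, ih _ _ hw]
      cases p <;> simp [e]

theorem turnsAvoid_iff_peaks_valleys (w : List Bool) (hw : IsDyck w) :
    TurnsAvoid true 0 w ↔ (∀ i, IsPeakAt w i → ∀ r : ℕ, ht w (i + 1) ≠ 5 * r + 1) ∧
      (∀ i, IsValleyAt w i → ∀ r : ℕ, ht w (i + 1) ≠ 5 * r + 1) := by
  have e (m : ℕ) : m % 5 ≠ 1 ↔ ∀ r : ℕ, m ≠ 5 * r + 1 :=
    ⟨fun h r => by omega, fun h h' => h (m / 5) (by omega)⟩
  rw [turnsAvoid_iff _ _ _ ((staysNonneg_iff _ 0).2 (by simpa using hw.2)),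
    ← Nat.and_forall_add_one]
  simp only [List.getElem?_cons_succ, Bool.forall_bool, zero_add, e, IsPeakAt, IsValleyAt, ht,
    Bool.not_true, Bool.not_false, and_imp, forall_and]
  simp
  tauto

open Classical in
/-- The generating function, by number of nodes, of the binary trees satisfying `P`. -/
noncomputable def treeGF (P : BinaryTree Unit → Prop) : PowerSeries ℤ :=
  PowerSeries.mk fun n => (#{t ∈ BinaryTree.treesOfNumNodesEq n | P t} : ℤ)

theorem treeGF_eq_add_mul {P Q R : BinaryTree Unit → Prop} (h0 : P .nil)
    (h : ∀ l r, P (.node () l r) ↔ Q l ∧ R r) :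
    treeGF P = 1 + X * (treeGF Q * treeGF R) := by
  classical
  ext n
  cases n with
  | zero => simp [treeGF, h0, Finset.filter_singleton]
  | succ n =>
    rw [map_add, PowerSeries.coeff_succ_X_mul, PowerSeries.coeff_mul]
    simp only [treeGF,
      PowerSeries.coeff_mk, PowerSeries.coeff_one, Nat.add_eq_zero_iff, one_ne_zero, and_false,
      if_false, zero_add]
    rw [BinaryTree.treesOfNumNodesEq_succ, Finset.filter_biUnion, Finset.card_biUnion]
    · push_cast
      refine Finset.sum_congr rfl fun ij _ => ?_
      rw [BinaryTree.pairwiseNode, Finset.filter_map, Finset.card_map, ← Nat.cast_mul,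
        ← Finset.card_product, ← Finset.filter_product]
      refine Nat.cast_inj.2 (congrArg Finset.card (Finset.filter_congr fun x _ => ?_))
      exact h x.1 x.2
    · intro x _ y _ hxy
      change Disjoint _ _
      rw [Finset.disjoint_left]
      aesop

theorem treeGF_and_ne_nil {P : BinaryTree Unit → Prop} (h0 : P .nil) :
    treeGF (fun t => P t ∧ t ≠ .nil) = treeGF P - 1 := by
  classical
  ext n
  cases n with
  | zero => simp [treeGF, h0, Finset.filter_singleton]
  | succ n =>
    simp only [map_sub, treeGF, PowerSeries.coeff_mk, PowerSeries.coeff_one, Nat.add_eq_zero_iff,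
      one_ne_zero, and_false, if_false, sub_zero, Nat.cast_inj]
    congr 1
    refine Finset.filter_congr fun t ht => ?_
    have : t ≠ .nil := by rintro rfl; simp at ht
    simp [this]

theorem treeGF_eq_nil : treeGF (fun t => t = .nil) = 1 := by
  classical
  ext n
  cases n with
  | zero => simp [treeGF, Finset.filter_singleton]
  | succ n =>
    simp only [treeGF, PowerSeries.coeff_mk, PowerSeries.coeff_one, Nat.add_eq_zero_iff,
      one_ne_zero, and_false, if_false, Nat.cast_eq_zero, Finset.card_eq_zero]
    refine Finset.filter_eq_empty_iff.2 fun t ht => ?_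
    rintro rfl
    simp at ht

theorem treeAvoids_nil (p : Bool) (h : ℕ) : TreeAvoids p h .nil := trivial

theorem treeAvoids_add_five (p : Bool) (h : ℕ) : TreeAvoids p (h + 5) = TreeAvoids p h := by
  ext t
  induction t generalizing p h with
  | nil => simp [TreeAvoids]
  | node _ l r hl hr =>
    simp [TreeAvoids, hr, show h + 5 + 1 = h + 1 + 5 by omega, hl]

theorem treeAvoids_false {h : ℕ} (hh : h % 5 ≠ 1) : TreeAvoids false h = TreeAvoids true h := by
  ext t
  cases t <;> simp [TreeAvoids, hh]

theorem treeGF_avoids {h : ℕ} (h0 : h % 5 ≠ 0) (h1 : h % 5 ≠ 1) :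
    treeGF (TreeAvoids true h) =
      1 + X * (treeGF (TreeAvoids true (h + 1)) * treeGF (TreeAvoids true h)) := by
  refine treeGF_eq_add_mul (treeAvoids_nil _ _) fun l r => ?_
  have : (h + 1) % 5 ≠ 1 := by omega
  simp [TreeAvoids, this, treeAvoids_false h1]

theorem treeGF_avoids_zero :
    treeGF (TreeAvoids true 0) =
      1 + X * ((treeGF (TreeAvoids true 1) - 1) * treeGF (TreeAvoids true 0)) := by
  rw [← treeGF_and_ne_nil (treeAvoids_nil true 1)]
  refine treeGF_eq_add_mul (treeAvoids_nil _ _) fun l r => ?_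
  simp [TreeAvoids, treeAvoids_false]

theorem treeGF_avoids_one :
    treeGF (TreeAvoids true 1) = 1 + X * (treeGF (TreeAvoids true 2) * 1) := by
  have h := treeGF_eq_add_mul (P := TreeAvoids true 1) (Q := TreeAvoids true 2)
    (R := fun t => t = .nil) (treeAvoids_nil _ _) fun l r => by cases r <;> simp [TreeAvoids]
  rwa [treeGF_eq_nil] at h

theorem card_dyck_eq_card_trees (n : ℕ) :
    Nat.card {w : List Bool // IsDyck w ∧ w.count true = n ∧
      (∀ i, IsPeakAt w i → ∀ r : ℕ, ht w (i + 1) ≠ 5 * r + 1) ∧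
      (∀ i, IsValleyAt w i → ∀ r : ℕ, ht w (i + 1) ≠ 5 * r + 1)} =
    Nat.card {t : BinaryTree Unit // t.numNodes = n ∧ TreeAvoids true 0 t} := by
  have key (t : BinaryTree Unit) : TreeAvoids true 0 t ↔
      (∀ i, IsPeakAt (treeWord t) i → ∀ r : ℕ, ht (treeWord t) (i + 1) ≠ 5 * r + 1) ∧
      (∀ i, IsValleyAt (treeWord t) i → ∀ r : ℕ, ht (treeWord t) (i + 1) ≠ 5 * r + 1) := by
    rw [← turnsAvoid_iff_peaks_valleys _ (isDyck_treeWord t)]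
    simpa [TurnsAvoid] using (turnsAvoid_treeWord_append t true 0 []).symm
  symm
  refine Nat.card_congr (Equiv.ofBijective (fun t => ⟨treeWord t.1, isDyck_treeWord t.1,
    (count_treeWord _ _).trans t.2.1, (key _).1 t.2.2⟩) ⟨fun t t' h => ?_, ?_⟩)
  · exact Subtype.ext (treeWord_injective (congrArg Subtype.val h))
  · rintro ⟨w, hw, hn, h⟩
    obtain ⟨t, rfl⟩ := exists_treeWord_of_isDyck w hw
    exact ⟨⟨t, (count_treeWord t true).symm.trans hn, (key t).2 h⟩, rfl⟩

/-- If `a n` counts Dyck paths of semi-length `n` in which no peak height and no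
valley height lies in `{5r + 1 : r ≥ 0}`, then `f = ∑ a(n) xⁿ` over `ℤ`
satisfies `(x³ + x² - x) f² + (x³ - 2x² - x + 1) f + 2x - 1 = 0`. -/
theorem statement13 (a : ℕ → ℕ)
    (ha : ∀ n, a n = Nat.card {w : List Bool // IsDyck w ∧ w.count true = n ∧
      (∀ i, IsPeakAt w i → ∀ r : ℕ, ht w (i + 1) ≠ 5 * r + 1) ∧
      (∀ i, IsValleyAt w i → ∀ r : ℕ, ht w (i + 1) ≠ 5 * r + 1)})
    (f : PowerSeries ℤ) (hf : f = PowerSeries.mk fun n => (a n : ℤ)) :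
    (PowerSeries.X ^ 3 + PowerSeries.X ^ 2 - PowerSeries.X) * f ^ 2 +
      (PowerSeries.X ^ 3 - 2 * PowerSeries.X ^ 2 - PowerSeries.X + 1) * f +
      2 * PowerSeries.X - 1 = 0 := by
  have hF : f = treeGF (TreeAvoids true 0) := by
    classical
    ext n
    rw [hf, PowerSeries.coeff_mk, ha, card_dyck_eq_card_trees, treeGF, PowerSeries.coeff_mk,
      Nat.cast_inj]
    exact Nat.subtype_card _ (by simp)
  have e0 := treeGF_avoids_zero
  have e1 := treeGF_avoids_one
  have e2 := treeGF_avoids (h := 2) (by norm_num) (by norm_num)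
  have e3 := treeGF_avoids (h := 3) (by norm_num) (by norm_num)
  have e4 := treeGF_avoids (h := 4) (by norm_num) (by norm_num)
  have e5 : TreeAvoids true (4 + 1) = TreeAvoids true 0 := treeAvoids_add_five true 0
  rw [e5] at e4
  norm_num only at e2 e3
  rw [← hF] at e0 e4
  rw [e1] at e0
  generalize treeGF (TreeAvoids true 2) = A at *
  generalize treeGF (TreeAvoids true 3) = B at *
  generalize treeGF (TreeAvoids true 4) = C at *
  have hB : B * (1 - X * f - X) = 1 - X * f := by
    linear_combination (1 - X * f) * e3 + X * B * e4
  have hA : A * (1 - 2 * X - X * f + X ^ 2 * f) = 1 - X - X * f := by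
    linear_combination (1 - X - X * f) * e2 + X * A * hB
  linear_combination (1 - 2 * X - X * f + X ^ 2 * f) * e0 + X ^ 2 * f * hA
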